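/- arXiv:1201.3914 — 13 statements merged into one kernel-verified Lean document; each statement's English description precedes it below -/
import Mathlib

section
/- Let d : ℕ → ℤ be finitely supported with |d i| ≤ 1 for all i. Then d has the truncation property (for every j : ℕ, 2 * |∑_{i < j} d i * 2^i| ≤ 2^j) if and only if d has the sign-alternation property: whenever i > j, d i ≠ 0, d j ≠ 0, and d k = 0 for all k with j < k < i, one has d i * d j < 0. -/
/-- The truncated sum is constant across a run of zero digits. -/
theorem sum_range_eq_of_zero_run {d : ℕ → ℤ} {j i : ℕ} (hji : j < i)
    (hz : ∀ k, j < k → k < i → d k = 0) :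
    ∑ k ∈ Finset.range i, d k * 2 ^ k = ∑ k ∈ Finset.range (j + 1), d k * 2 ^ k := by
  symm
  refine Finset.sum_subset (Finset.range_subset_range.2 hji) fun k hk hk' => ?_
  rw [Finset.mem_range] at hk hk'
  rw [hz k (by omega) hk, zero_mul]

theorem eq_one_or_neg_one_of_abs_le_one {a : ℤ} (ha : |a| ≤ 1) (h0 : a ≠ 0) :
    a = 1 ∨ a = -1 := by
  rw [abs_le] at ha
  omega

theorem mul_neg_of_truncation {d : ℕ → ℤ} (hb : ∀ i, |d i| ≤ 1)
    (h : ∀ j : ℕ, 2 * |∑ i ∈ Finset.range j, d i * 2 ^ i| ≤ 2 ^ j)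
    {i j : ℕ} (hji : j < i) (hi : d i ≠ 0) (hj : d j ≠ 0)
    (hz : ∀ k, j < k → k < i → d k = 0) : d i * d j < 0 := by
  have hS := sum_range_eq_of_zero_run hji hz
  rw [Finset.sum_range_succ] at hS
  have h1 := h j
  have h2 := h (i + 1)
  rw [Finset.sum_range_succ, hS, pow_succ] at h2
  have hpos : (0 : ℤ) < 2 ^ j := by positivity
  generalize ∑ k ∈ Finset.range j, d k * 2 ^ k = s at h1 h2
  have h1l := neg_abs_le s
  have h1u := le_abs_self s
  rcases eq_one_or_neg_one_of_abs_le_one (hb i) hi with ei | ei <;>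
    rcases eq_one_or_neg_one_of_abs_le_one (hb j) hj with ej | ej <;>
    rw [ei, ej] at h2 ⊢ <;> norm_num
  · have := le_abs_self (s + 1 * 2 ^ j + 1 * 2 ^ i)
    linarith
  · have := neg_abs_le (s + -1 * 2 ^ j + -1 * 2 ^ i)
    linarith

/-- Under sign alternation, a truncated sum has the sign of its leading nonzero digit and is
at most the weight of that digit. -/
theorem sum_range_eq_zero_or_sign_of_alternation {d : ℕ → ℤ} (hb : ∀ i, |d i| ≤ 1)
    (h : ∀ i j : ℕ, j < i → d i ≠ 0 → d j ≠ 0 →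
      (∀ k, j < k → k < i → d k = 0) → d i * d j < 0) (j : ℕ) :
    ∑ i ∈ Finset.range j, d i * 2 ^ i = 0 ∨
      ∃ k < j, d k ≠ 0 ∧ (∀ l, k < l → l < j → d l = 0) ∧
        0 < d k * ∑ i ∈ Finset.range j, d i * 2 ^ i ∧
        d k * ∑ i ∈ Finset.range j, d i * 2 ^ i ≤ 2 ^ k := by
  induction j with
  | zero => simp
  | succ j ih =>
    rw [Finset.sum_range_succ]
    by_cases hj : d j = 0
    · rw [hj, zero_mul, add_zero]
      refine ih.imp_right ?_
      rintro ⟨k, hk, hdk, hz, hs⟩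
      refine ⟨k, by omega, hdk, fun l hl hl' => ?_, hs⟩
      rcases Nat.lt_succ_iff_lt_or_eq.1 hl' with hlj | rfl
      exacts [hz l hl hlj, hj]
    · refine Or.inr ⟨j, j.lt_succ_self, hj, fun l hl hl' => by omega, ?_⟩
      have hpos : (0 : ℤ) < 2 ^ j := by positivity
      rcases ih with h0 | ⟨k, hk, hdk, hz, hs, hs'⟩
      · rw [h0]
        rcases eq_one_or_neg_one_of_abs_le_one (hb j) hj with e | e <;> rw [e] <;>
          constructor <;> linarith
      · have hneg := h j k hk hj hdk hz
        have hlt : (2 : ℤ) ^ k < 2 ^ j := pow_lt_pow_right₀ (by norm_num) hk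
        rcases eq_one_or_neg_one_of_abs_le_one (hb j) hj with ej | ej <;>
          rcases eq_one_or_neg_one_of_abs_le_one (hb k) hdk with ek | ek <;>
          rw [ek] at hs hs' hneg <;> rw [ej] at hneg ⊢ <;> norm_num at hneg <;>
          constructor <;> linarith

theorem truncation_of_alternation {d : ℕ → ℤ} (hb : ∀ i, |d i| ≤ 1)
    (h : ∀ i j : ℕ, j < i → d i ≠ 0 → d j ≠ 0 →
      (∀ k, j < k → k < i → d k = 0) → d i * d j < 0) (j : ℕ) :
    2 * |∑ i ∈ Finset.range j, d i * 2 ^ i| ≤ 2 ^ j := by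
  rcases sum_range_eq_zero_or_sign_of_alternation hb h j with h0 | ⟨k, hk, hdk, -, hs, hs'⟩
  · rw [h0]
    simp
  · have hle : (2 : ℤ) ^ (k + 1) ≤ 2 ^ j := pow_le_pow_right₀ (by norm_num) hk
    rw [pow_succ] at hle
    have habs : |∑ i ∈ Finset.range j, d i * 2 ^ i| ≤ 2 ^ k := by
      rw [abs_le]
      rcases eq_one_or_neg_one_of_abs_le_one (hb k) hdk with e | e <;> rw [e] at hs hs' <;>
        constructor <;> linarith
    linarith


/-- For a finitely supported digit function `d : ℕ → ℤ` with
`|d i| ≤ 1`, the truncation property (truncating at any position `j` leaves a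
value within half a unit `2^j`) holds iff the nonzero digits alternate in sign. -/
theorem truncation_iff_sign_alternation (d : ℕ → ℤ)
    (hfin : ∃ N, ∀ i ≥ N, d i = 0) (hb : ∀ i, |d i| ≤ 1) :
    (∀ j : ℕ, 2 * |∑ i ∈ Finset.range j, d i * 2 ^ i| ≤ 2 ^ j) ↔
      (∀ i j : ℕ, j < i → d i ≠ 0 → d j ≠ 0 →
        (∀ k, j < k → k < i → d k = 0) → d i * d j < 0) := by
  exact ⟨fun h _ _ hji hi hj hz => mul_neg_of_truncation hb h hji hi hj hz,
    truncation_of_alternation hb⟩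
end

section
/- Let d : ℕ → ℤ be an RN-representation of the integer x. Then for every j : ℕ, the truncated value T_j := ∑_{i ≥ j} d i * 2^i (a finite sum) is divisible by 2^j, and it is a nearest multiple of 2^j to x: for every integer m, |x − T_j| ≤ |x − m * 2^j|. -/
/-- An integer of absolute value at most `M / 2` is of least absolute value in its class modulo `M`. -/
theorem abs_le_abs_add_mul_of_two_mul_abs_le {s M : ℤ} (h : 2 * |s| ≤ M) (k : ℤ) :
    |s| ≤ |s + k * M| := by
  rcases eq_or_ne k 0 with rfl | hk
  · simp
  have hM : 0 ≤ M := le_trans (by positivity) h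
  have hkM : M ≤ |k * M| := by
    rw [abs_mul, abs_of_nonneg hM]
    exact le_mul_of_one_le_left hM (Int.one_le_abs hk)
  have htri : |k * M| ≤ |s + k * M| + |s| := by
    simpa using abs_sub (s + k * M) s
  linarith

/-- If `d` is an RN-representation of the integer `x`
(finitely supported with support bound `N`, digits of absolute value at most 1,
truncation property, and total value `x`), then for every `j` the truncated
value `T_j = ∑_{i ≥ j} d i * 2^i` is a multiple of `2^j` and is a nearest
multiple of `2^j` to `x`. -/
theorem truncated_value_is_nearest (d : ℕ → ℤ) (x : ℤ) (N : ℕ)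
    (hfin : ∀ i ≥ N, d i = 0) (hb : ∀ i, |d i| ≤ 1)
    (htrunc : ∀ j : ℕ, 2 * |∑ i ∈ Finset.range j, d i * 2 ^ i| ≤ 2 ^ j)
    (hsum : ∑ i ∈ Finset.range N, d i * 2 ^ i = x) (j : ℕ) :
    (2 ^ j : ℤ) ∣ (∑ i ∈ Finset.Ico j N, d i * 2 ^ i) ∧
      ∀ m : ℤ, |x - ∑ i ∈ Finset.Ico j N, d i * 2 ^ i| ≤ |x - m * 2 ^ j| := by
  have hdvd : (2 ^ j : ℤ) ∣ ∑ i ∈ Finset.Ico j N, d i * 2 ^ i :=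
    Finset.dvd_sum fun i hi =>
      (pow_dvd_pow 2 (Finset.mem_Ico.mp hi).1).mul_left (d i)
  refine ⟨hdvd, fun m => ?_⟩
  have hsplit : ∑ i ∈ Finset.range j, d i * 2 ^ i + ∑ i ∈ Finset.Ico j N, d i * 2 ^ i = x := by
    rcases le_total j N with hj | hj
    · rw [Finset.sum_range_add_sum_Ico _ hj, hsum]
    · rw [Finset.Ico_eq_empty_of_le hj, Finset.sum_empty, add_zero, ← hsum]
      refine (Finset.sum_subset (Finset.range_mono hj) fun i _ hi => ?_).symm
      rw [hfin i (by simpa using hi), zero_mul]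
  obtain ⟨c, hc⟩ := hdvd
  rw [hc] at hsplit ⊢
  convert abs_le_abs_add_mul_of_two_mul_abs_le (htrunc j) (c - m) using 2 <;> linarith
end

section
/- Let d : ℕ → ℤ be an RN-representation of the integer x, and suppose k is the least index with d k ≠ 0 and that d k = 1. Define d' : ℕ → ℤ by d' k = −1, d' (k+1) = d (k+1) + 1, and d' i = d i for all other i. Then d' is again an RN-representation of x; in particular |d' i| ≤ 1 for all i, d' has the truncation property, and ∑ i, d' i * 2^i = x. -/
/-- If `d` is an RN-representation of `x` whose least
significant nonzero digit is `d k = 1`, then rewriting the tail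
`…d(k+1) 1 0…0` as `…(d(k+1)+1) (−1) 0…0` yields again an RN-representation
of `x`. -/
theorem alternative_representation (d : ℕ → ℤ) (x : ℤ) (N : ℕ)
    (hfin : ∀ i ≥ N, d i = 0) (hb : ∀ i, |d i| ≤ 1)
    (htrunc : ∀ j : ℕ, 2 * |∑ i ∈ Finset.range j, d i * 2 ^ i| ≤ 2 ^ j)
    (hsum : ∑ i ∈ Finset.range N, d i * 2 ^ i = x)
    (k : ℕ) (hk1 : d k = 1) (hleast : ∀ j < k, d j = 0)
    (d' : ℕ → ℤ)
    (hd'k : d' k = -1) (hd'k1 : d' (k + 1) = d (k + 1) + 1)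
    (hd' : ∀ i, i ≠ k → i ≠ k + 1 → d' i = d i) :
    (∀ i, |d' i| ≤ 1) ∧
      (∀ j : ℕ, 2 * |∑ i ∈ Finset.range j, d' i * 2 ^ i| ≤ 2 ^ j) ∧
      ∃ M, (∀ i ≥ M, d' i = 0) ∧ ∑ i ∈ Finset.range M, d' i * 2 ^ i = x := by
  have hlow : ∀ i < k, d' i = 0 := fun i hi => by
    rw [hd' i (by omega) (by omega), hleast i hi]
  have hS : ∑ i ∈ Finset.range k, d i * 2 ^ i = 0 :=
    Finset.sum_eq_zero fun i hi => by rw [hleast i (Finset.mem_range.mp hi), zero_mul]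
  have hS' : ∀ j ≤ k, ∑ i ∈ Finset.range j, d' i * 2 ^ i = 0 := fun j hj =>
    Finset.sum_eq_zero fun i hi => by
      rw [hlow i (lt_of_lt_of_le (Finset.mem_range.mp hi) hj), zero_mul]
  have hpow : (0 : ℤ) < 2 ^ k := by positivity
  have hne : d (k + 1) ≤ 0 := by
    by_contra! hpos
    have h1 : d (k + 1) = 1 := le_antisymm (abs_le.mp (hb (k + 1))).2 hpos
    have h := htrunc (k + 2)
    rw [Finset.sum_range_succ, Finset.sum_range_succ, hS, hk1, h1] at h
    have h2 := le_abs_self ((0 : ℤ) + 1 * 2 ^ k + 1 * 2 ^ (k + 1))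
    rw [pow_succ] at h2 h
    rw [pow_add] at h
    linarith
  have heq : ∀ j, k + 2 ≤ j →
      ∑ i ∈ Finset.range j, d' i * 2 ^ i = ∑ i ∈ Finset.range j, d i * 2 ^ i := by
    intro j hj
    induction j, hj using Nat.le_induction with
    | base =>
      simp only [Finset.sum_range_succ, hS, hS' k le_rfl, hk1, hd'k, hd'k1, pow_succ]
      ring
    | succ j hj ih =>
      rw [Finset.sum_range_succ, Finset.sum_range_succ, ih, hd' j (by omega) (by omega)]
  refine ⟨fun i => ?_, fun j => ?_, max N (k + 2), fun i hi => ?_, ?_⟩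
  · by_cases h1 : i = k
    · simp [h1, hd'k]
    by_cases h2 : i = k + 1
    · rw [h2, hd'k1, abs_le]
      have := (abs_le.mp (hb (k + 1))).1
      constructor <;> linarith
    · rw [hd' i h1 h2]
      exact hb i
  · rcases lt_trichotomy j (k + 1) with hj | rfl | hj
    · rw [hS' j (by omega)]
      simp
    · rw [Finset.sum_range_succ, hS' k le_rfl, hd'k, zero_add, neg_one_mul, abs_neg,
        abs_of_pos hpow, pow_succ']
    · rw [heq j hj]
      exact htrunc j
  · have := max_le_iff.mp hi
    rw [hd' i (by omega) (by omega), hfin i this.1]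
  · rw [heq _ (le_max_right _ _), ← hsum]
    refine (Finset.sum_subset (Finset.range_mono (le_max_left _ _)) fun i _ hi => ?_).symm
    rw [hfin i (by simpa using hi), zero_mul]
end

section
/- For every nonzero integer x, the set of RN-representations of x (finitely supported d : ℕ → ℤ with |d i| ≤ 1, the truncation property, and ∑ i, d i * 2^i = x) has exactly two elements; moreover, of these two, exactly one has its least significant nonzero digit equal to −1 (and the other has its least significant nonzero digit equal to 1). -/
/-- `d` is an RN-representation of the integer `x`: finitely supported digits in
`{-1,0,1}` with the truncation property, summing to `x`. -/
def IsRNRep (x : ℤ) (d : ℕ → ℤ) : Prop :=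
  (∀ i, |d i| ≤ 1) ∧
  (∀ j : ℕ, 2 * |∑ i ∈ Finset.range j, d i * 2 ^ i| ≤ 2 ^ j) ∧
  ∃ N, (∀ i ≥ N, d i = 0) ∧ ∑ i ∈ Finset.range N, d i * 2 ^ i = x

theorem two_pow_dvd_sum_digits_sub (d : ℕ → ℤ) {j m : ℕ} (h : j ≤ m) :
    (2 : ℤ) ^ j ∣ ∑ i ∈ Finset.range m, d i * 2 ^ i - ∑ i ∈ Finset.range j, d i * 2 ^ i := by
  rw [← Finset.sum_Ico_eq_sub _ h]
  exact Finset.dvd_sum fun i hi ↦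
    Dvd.dvd.mul_left (pow_dvd_pow 2 (Finset.mem_Ico.mp hi).1) _

theorem sum_digits_ne_zero {d : ℕ → ℤ} {k j : ℕ} (hkj : k < j) (hk : |d k| ≤ 1) (hk0 : d k ≠ 0)
    (h : ∀ i < k, d i = 0) : ∑ i ∈ Finset.range j, d i * 2 ^ i ≠ 0 := by
  intro h0
  have hdvd := two_pow_dvd_sum_digits_sub d (Nat.succ_le_of_lt hkj)
  rw [h0, Finset.sum_range_succ, Finset.sum_eq_zero, zero_add, zero_sub, dvd_neg, pow_succ',
    mul_dvd_mul_iff_right (by positivity)] at hdvd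
  · rw [abs_le] at hk
    lia
  · intro i hi
    simp [h i (Finset.mem_range.mp hi)]

theorem sum_bits_eq_emod (y : ℤ) (j : ℕ) :
    ∑ i ∈ Finset.range j, y / 2 ^ i % 2 * 2 ^ i = y % 2 ^ j := by
  induction j with
  | zero => simp
  | succ j ih =>
    rw [Finset.sum_range_succ, ih, pow_succ]
    have h1 := Int.emod_add_mul_ediv y (2 ^ j)
    have h2 := Int.emod_add_mul_ediv y (2 ^ j * 2)
    have h3 := Int.emod_add_mul_ediv (y / 2 ^ j) 2
    rw [Int.ediv_ediv_of_nonneg (by positivity)] at h3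
    linear_combination h1 - h2 + 2 ^ j * h3

namespace IsRNRep

variable {x : ℤ} {d e : ℕ → ℤ}

theorem two_pow_dvd_sub (hd : IsRNRep x d) (j : ℕ) :
    (2 : ℤ) ^ j ∣ x - ∑ i ∈ Finset.range j, d i * 2 ^ i := by
  obtain ⟨-, -, N, hN, rfl⟩ := hd
  rcases le_total j N with h | h
  · exact two_pow_dvd_sum_digits_sub d h
  · rw [← Finset.sum_range_add_sum_Ico _ h, Finset.sum_eq_zero (s := Finset.Ico N j)]
    · simp
    · intro i hi
      simp [hN i (Finset.mem_Ico.mp hi).1]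

theorem neg (hd : IsRNRep x d) : IsRNRep (-x) (-d) := by
  obtain ⟨h1, h2, N, hN, hx⟩ := hd
  refine ⟨by simpa using h1, by simpa using h2, N, fun i hi ↦ by simp [hN i hi], ?_⟩
  simp [hx]

theorem exists_first_digit (hd : IsRNRep x d) (hx : x ≠ 0) :
    ∃ k, (d k = -1 ∨ d k = 1) ∧ ∀ j < k, d j = 0 := by
  have hex : ∃ k, d k ≠ 0 := by
    by_contra! h
    obtain ⟨-, -, N, -, rfl⟩ := hd
    simp [h] at hx
  classical
  refine ⟨Nat.find hex, ?_, fun j hj ↦ by simpa using Nat.find_min hex hj⟩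
  have h0 := Nat.find_spec hex
  have h1 := abs_le.mp (hd.1 (Nat.find hex))
  lia

theorem eq_of_first_digit_eq (hd : IsRNRep x d) (he : IsRNRep x e) {s : ℤ} (hs : s ≠ 0)
    (hds : ∃ k, d k = s ∧ ∀ j < k, d j = 0) (hes : ∃ k, e k = s ∧ ∀ j < k, e j = 0) :
    d = e := by
  have first {c : ℕ → ℤ} (hc : IsRNRep x c) (hcs : ∃ k, c k = s ∧ ∀ j < k, c j = 0) {j : ℕ}
      (h0 : ∑ i ∈ Finset.range j, c i * 2 ^ i = 0) (hj : c j ≠ 0) : c j = s := by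
    obtain ⟨k, rfl, hk⟩ := hcs
    rcases lt_trichotomy k j with h | rfl | h
    · exact absurd h0 (sum_digits_ne_zero h (hc.1 k) hs hk)
    · rfl
    · exact absurd (hk j h) hj
  funext j
  induction j using Nat.strong_induction_on with
  | _ j ih =>
    have hS : ∑ i ∈ Finset.range j, d i * 2 ^ i = ∑ i ∈ Finset.range j, e i * 2 ^ i :=
      Finset.sum_congr rfl fun i hi ↦ by rw [ih i (Finset.mem_range.mp hi)]
    by_contra hne
    have hdvd := dvd_sub (he.two_pow_dvd_sub (j + 1)) (hd.two_pow_dvd_sub (j + 1))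
    have hbd := hd.2.1 (j + 1)
    have hbe := he.2.1 (j + 1)
    have hd1 := abs_le.mp (hd.1 j)
    have he1 := abs_le.mp (he.1 j)
    have fd := first hd hds (j := j)
    have fe := first he hes (j := j)
    simp only [Finset.sum_range_succ] at hdvd hbd hbe
    rw [← hS] at hdvd hbe fe
    generalize ∑ i ∈ Finset.range j, d i * 2 ^ i = S at *
    rw [show x - (S + e j * 2 ^ j) - (x - (S + d j * 2 ^ j)) = (d j - e j) * 2 ^ j by ring,
      pow_succ', mul_dvd_mul_iff_right (by positivity)] at hdvd
    rw [pow_succ', mul_le_mul_iff_right₀ (by norm_num), abs_le] at hbd hbe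
    have hcases : d j = 1 ∧ e j = -1 ∨ d j = -1 ∧ e j = 1 := by lia
    have hS0 : S = 0 := by
      rcases hcases with ⟨h1, h2⟩ | ⟨h1, h2⟩ <;> rw [h1] at hbd <;> rw [h2] at hbe <;> linarith
    have := fd hS0 (by lia)
    have := fe hS0 (by lia)
    lia

end IsRNRep

/-- The Booth recoding of `x`: differences of consecutive bits `x / 2 ^ i % 2` of `x`. -/
def boothDigit (x : ℤ) (i : ℕ) : ℤ :=
  2 * x / 2 ^ i % 2 - x / 2 ^ i % 2

theorem sum_boothDigit (x : ℤ) (j : ℕ) :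
    ∑ i ∈ Finset.range j, boothDigit x i * 2 ^ i = 2 * x % 2 ^ j - x % 2 ^ j := by
  simp only [boothDigit, sub_mul, Finset.sum_sub_distrib, sum_bits_eq_emod]

theorem isRNRep_boothDigit (x : ℤ) : IsRNRep x (boothDigit x) := by
  refine ⟨fun i ↦ ?_, fun j ↦ ?_, (2 * x).natAbs, ?_⟩
  · rw [boothDigit, abs_le]
    lia
  · rw [sum_boothDigit]
    cases j with
    | zero => simp
    | succ j =>
      have h1 := Int.emod_emod_of_dvd x (pow_dvd_pow (2 : ℤ) (Nat.le_succ j))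
      have hp : (0 : ℤ) < 2 ^ j := by positivity
      rw [Nat.succ_eq_add_one] at h1
      rw [pow_succ', Int.mul_emod_mul_of_pos _ _ two_pos] at *
      have h2 := Int.emod_nonneg x (b := 2 * 2 ^ j) (by positivity)
      have h3 := Int.emod_lt_of_pos x (b := 2 * 2 ^ j) (by positivity)
      rw [← h1, mul_le_mul_iff_right₀ two_pos, abs_le]
      generalize x % (2 * 2 ^ j) = r at *
      rcases lt_or_ge r (2 ^ j) with h | h
      · rw [Int.emod_eq_of_lt h2 h]
        lia
      · rw [← Int.sub_emod_right, Int.emod_eq_of_lt (by lia) (by lia)]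
        lia
  · have hlt {i : ℕ} (hi : (2 * x).natAbs ≤ i) : |2 * x| < 2 ^ i := by
      rw [Int.abs_eq_natAbs]
      exact_mod_cast hi.trans_lt Nat.lt_two_pow_self
    have hneg {y p : ℤ} (h0 : y < 0) (h : -p ≤ y) : y / p = -1 ∧ y % p = y + p := by
      rw [Int.ediv_emod_unique (by lia)]
      constructor <;> lia
    constructor
    · intro i hi
      have h := abs_lt.mp (hlt hi)
      rcases lt_or_ge x 0 with h0 | h0
      · rw [boothDigit, (hneg (by lia) (by lia)).1, (hneg h0 (by lia)).1, sub_self]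
      · rw [boothDigit, Int.ediv_eq_zero_of_lt (by lia) h.2,
          Int.ediv_eq_zero_of_lt h0 (by lia), sub_self]
    · have h := abs_lt.mp (hlt le_rfl)
      rw [sum_boothDigit]
      rcases lt_or_ge x 0 with h0 | h0
      · rw [(hneg (by lia) (by lia)).2, (hneg h0 (by lia)).2]
        ring
      · rw [Int.emod_eq_of_lt (by lia) h.2, Int.emod_eq_of_lt h0 (by lia)]
        ring

theorem boothDigit_first_digit {x : ℤ} (hx : x ≠ 0) :
    ∃ k, boothDigit x k = -1 ∧ ∀ j < k, boothDigit x j = 0 := by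
  obtain ⟨m, hm, h2⟩ := (Int.finiteMultiplicity_iff.mpr ⟨by decide, hx⟩ :
    FiniteMultiplicity (2 : ℤ) x).exists_eq_pow_mul_and_not_dvd
  generalize multiplicity 2 x = k at hm
  subst hm
  have hdiv (j : ℕ) (y : ℤ) : 2 ^ j * y / 2 ^ j = y :=
    Int.mul_ediv_cancel_left _ (by positivity)
  refine ⟨k, ?_, fun j hj ↦ ?_⟩
  · rw [boothDigit, mul_left_comm, hdiv, hdiv]
    lia
  · obtain ⟨t, rfl⟩ := Nat.exists_eq_add_of_lt hj
    rw [boothDigit, mul_left_comm, show (2 : ℤ) ^ (j + t + 1) = 2 ^ j * (2 * 2 ^ t) by ring,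
      mul_assoc, mul_assoc, hdiv, mul_left_comm 2, mul_assoc, hdiv]
    lia

/-- Every nonzero integer has exactly two RN-representations:
exactly one with least significant nonzero digit `−1`, and exactly one with
least significant nonzero digit `1`. -/
theorem two_RN_representations (x : ℤ) (hx : x ≠ 0) :
    {d : ℕ → ℤ | IsRNRep x d}.ncard = 2 ∧
      (∃! d : ℕ → ℤ, IsRNRep x d ∧ ∃ k, d k = -1 ∧ ∀ j < k, d j = 0) ∧
      (∃! d : ℕ → ℤ, IsRNRep x d ∧ ∃ k, d k = 1 ∧ ∀ j < k, d j = 0) := by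
  obtain ⟨d, hd, hdk⟩ : ∃ d, IsRNRep x d ∧ ∃ k, d k = -1 ∧ ∀ j < k, d j = 0 :=
    ⟨_, isRNRep_boothDigit x, boothDigit_first_digit hx⟩
  obtain ⟨e, he, hek⟩ : ∃ e, IsRNRep x e ∧ ∃ k, e k = 1 ∧ ∀ j < k, e j = 0 := by
    obtain ⟨k, hk, hlt⟩ := boothDigit_first_digit (neg_ne_zero.mpr hx)
    exact ⟨-boothDigit (-x), by simpa using (isRNRep_boothDigit (-x)).neg,
      k, by simp [hk], fun j hj ↦ by simp [hlt j hj]⟩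
  refine ⟨?_, ⟨d, ⟨hd, hdk⟩, fun c hc ↦ hc.1.eq_of_first_digit_eq hd (by decide) hc.2 hdk⟩,
    ⟨e, ⟨he, hek⟩, fun c hc ↦ hc.1.eq_of_first_digit_eq he (by decide) hc.2 hek⟩⟩
  rw [Set.ncard_eq_two]
  refine ⟨d, e, ?_, ?_⟩
  · rintro rfl
    obtain ⟨k, hk, hklt⟩ := hdk
    obtain ⟨l, hl, hllt⟩ := hek
    have h1 := hklt l
    have h2 := hllt k
    rcases lt_trichotomy k l with h | rfl | h <;> lia
  · ext c
    simp only [Set.mem_ofPred_eq, Set.mem_insert_iff, Set.mem_singleton_iff]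
    constructor
    · intro hc
      obtain ⟨k, hk | hk, hlt⟩ := hc.exists_first_digit hx
      · exact .inl (hc.eq_of_first_digit_eq hd (by decide) ⟨k, hk, hlt⟩ hdk)
      · exact .inr (hc.eq_of_first_digit_eq he (by decide) ⟨k, hk, hlt⟩ hek)
    · rintro (rfl | rfl) <;> assumption
end

section
/- Let m ≥ 1 and b : ℕ → ℤ with b i ∈ {0,1} for all i ≤ m, and let x = −(b m) * 2^m + ∑_{i < m} b i * 2^i be the value of the 2's complement bit string b_m … b_0. Define the Booth recoding δ : ℕ → ℤ by δ 0 = −(b 0), δ i = b (i−1) − b i for 1 ≤ i ≤ m, and δ i = 0 for i > m. Then ∑_{i ≤ m} δ i * 2^i = x, |δ i| ≤ 1 for all i, and δ has the truncation property: for every j : ℕ, 2 * |∑_{i < j} δ i * 2^i| ≤ 2^j. -/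
/-- A prefix of the Booth recoding has the value of the 2's complement string `b_n … b_0`. -/
theorem sum_range_succ_booth {m : ℕ} {b δ : ℕ → ℤ} (hδ0 : δ 0 = -(b 0))
    (hδ : ∀ i, 1 ≤ i → i ≤ m → δ i = b (i - 1) - b i) {n : ℕ} (hn : n ≤ m) :
    ∑ i ∈ Finset.range (n + 1), δ i * 2 ^ i =
      -(b n) * 2 ^ n + ∑ i ∈ Finset.range n, b i * 2 ^ i := by
  induction n with
  | zero => simp [hδ0]
  | succ n ih =>
    rw [Finset.sum_range_succ, ih (by omega), hδ (n + 1) (by omega) hn,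
      Finset.sum_range_succ (fun i => b i * 2 ^ i), Nat.add_sub_cancel]
    ring

theorem sum_bits_nonneg_and_lt_two_pow {b : ℕ → ℤ} {n : ℕ}
    (hb : ∀ i < n, b i = 0 ∨ b i = 1) :
    0 ≤ ∑ i ∈ Finset.range n, b i * 2 ^ i ∧ ∑ i ∈ Finset.range n, b i * 2 ^ i < 2 ^ n := by
  induction n with
  | zero => simp
  | succ n ih =>
    obtain ⟨h0, h1⟩ := ih fun i hi => hb i (by omega)
    have hpow : (0 : ℤ) < 2 ^ n := by positivity
    rw [Finset.sum_range_succ, pow_succ]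
    rcases hb n (by omega) with h | h <;> rw [h] <;> constructor <;> linarith

theorem abs_twos_complement_le {b : ℕ → ℤ} {n : ℕ} (hb : ∀ i ≤ n, b i = 0 ∨ b i = 1) :
    |-(b n) * 2 ^ n + ∑ i ∈ Finset.range n, b i * 2 ^ i| ≤ 2 ^ n := by
  obtain ⟨h0, h1⟩ := sum_bits_nonneg_and_lt_two_pow fun i hi => hb i (le_of_lt hi)
  rw [abs_le]
  rcases hb n le_rfl with h | h <;> rw [h] <;> constructor <;> linarith


/-- The Booth recoding `δ i = b (i−1) − b i` (with `b₋₁ = 0`)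
of a 2's complement bit string `b_m … b_0` represents the same value `x`, has
digits in `{−1,0,1}`, and satisfies the truncation property. -/
theorem booth_recoding_is_RN (m : ℕ) (hm : 1 ≤ m) (b : ℕ → ℤ)
    (hb : ∀ i ≤ m, b i = 0 ∨ b i = 1) (x : ℤ)
    (hx : x = -(b m) * 2 ^ m + ∑ i ∈ Finset.range m, b i * 2 ^ i)
    (δ : ℕ → ℤ) (hδ0 : δ 0 = -(b 0))
    (hδ : ∀ i, 1 ≤ i → i ≤ m → δ i = b (i - 1) - b i)
    (hδtop : ∀ i, m < i → δ i = 0) :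
    (∑ i ∈ Finset.range (m + 1), δ i * 2 ^ i = x) ∧
      (∀ i, |δ i| ≤ 1) ∧
      (∀ j : ℕ, 2 * |∑ i ∈ Finset.range j, δ i * 2 ^ i| ≤ 2 ^ j) := by
  have hprefix : ∀ n ≤ m, 2 * |∑ i ∈ Finset.range (n + 1), δ i * 2 ^ i| ≤ 2 ^ (n + 1) := by
    intro n hn
    rw [sum_range_succ_booth hδ0 hδ hn, pow_succ']
    gcongr
    exact abs_twos_complement_le fun i hi => hb i (hi.trans hn)
  refine ⟨by rw [hx, sum_range_succ_booth hδ0 hδ le_rfl], fun i => ?_, fun j => ?_⟩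
  · rcases lt_or_ge m i with hi | hi
    · simp [hδtop i hi]
    · rcases Nat.eq_zero_or_pos i with rfl | hpos
      · rcases hb 0 hi with h | h <;> simp [hδ0, h]
      · rw [hδ i hpos hi]
        rcases hb i hi with h | h <;> rcases hb (i - 1) (by omega) with h' | h' <;>
          simp [h, h']
  · rcases lt_or_ge j (m + 1) with hj | hj
    · cases j with
      | zero => simp
      | succ n => exact hprefix n (by omega)
    · rw [← Finset.sum_subset (Finset.range_mono hj) fun i _ hi => by
        rw [hδtop i (by simpa using hi), zero_mul]]
      exact (hprefix m le_rfl).trans (pow_le_pow_right₀ (by norm_num) hj)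
end

section
/- Let m ≥ k ≥ 1 and b : ℕ → ℤ with b i ∈ {0,1} for all i ≤ m, and let x = −(b m) * 2^m + ∑_{i < m} b i * 2^i. Define the truncated value with appended round bit v = −(b m) * 2^m + ∑_{k ≤ i < m} b i * 2^i + b (k−1) * 2^k. Then 2^k divides v, and v is a nearest multiple of 2^k to x: for every integer n, |x − v| ≤ |x − n * 2^k|. -/
/-- A binary number with `n` digits lies in the interval `[0, 2 ^ n)`. -/
theorem sum_bits_mem_Ico (b : ℕ → ℤ) (n : ℕ) (hb : ∀ i < n, b i = 0 ∨ b i = 1) :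
    ∑ i ∈ Finset.range n, b i * 2 ^ i ∈ Set.Ico (0 : ℤ) (2 ^ n) := by
  induction n with
  | zero => simp
  | succ n ih =>
    obtain ⟨h₀, h₁⟩ := ih fun i hi => hb i (by omega)
    rw [Finset.sum_range_succ, Set.mem_Ico, pow_succ]
    rcases hb n (by omega) with h | h <;> rw [h] <;> constructor <;> linarith

/-- A multiple of `M` at distance at most `M / 2` from `x` is a nearest multiple of `M`. -/
theorem abs_sub_mul_le_abs_sub_mul {x q M : ℤ} (h : 2 * |x - q * M| ≤ M) (n : ℤ) :
    |x - q * M| ≤ |x - n * M| := by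
  rcases eq_or_ne n q with rfl | hne
  · rfl
  have hM : 0 ≤ M := (by positivity : (0 : ℤ) ≤ 2 * |x - q * M|).trans h
  have hdist : M ≤ |(n - q) * M| := by
    rw [abs_mul, abs_of_nonneg hM]
    exact le_mul_of_one_le_left hM (Int.one_le_abs (sub_ne_zero.mpr hne))
  have htri : |(n - q) * M| ≤ |x - q * M| + |x - n * M| := by
    rw [show (n - q) * M = (x - q * M) - (x - n * M) by ring]
    exact abs_sub _ _
  linarith

/-- Truncating a 2's complement number at position `k` and
appending the bit `b (k−1)` as a round bit of weight `2^k` yields a multiple of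
`2^k` which is a nearest multiple of `2^k` to the original value `x`. -/
theorem canonical_truncation_rounds_to_nearest (m k : ℕ) (hk : 1 ≤ k)
    (hkm : k ≤ m) (b : ℕ → ℤ) (hb : ∀ i ≤ m, b i = 0 ∨ b i = 1) (x v : ℤ)
    (hx : x = -(b m) * 2 ^ m + ∑ i ∈ Finset.range m, b i * 2 ^ i)
    (hv : v = -(b m) * 2 ^ m + (∑ i ∈ Finset.Ico k m, b i * 2 ^ i) +
        b (k - 1) * 2 ^ k) :
    (2 ^ k : ℤ) ∣ v ∧ ∀ n : ℤ, |x - v| ≤ |x - n * 2 ^ k| := by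
  obtain ⟨j, rfl⟩ := Nat.exists_eq_add_of_le' hk
  have hdvd : (2 ^ (j + 1) : ℤ) ∣ v := by
    rw [hv]
    refine dvd_add (dvd_add ((pow_dvd_pow 2 hkm).mul_left _) ?_) (dvd_mul_left _ _)
    exact Finset.dvd_sum fun i hi =>
      (pow_dvd_pow 2 (Finset.mem_Ico.mp hi).1).mul_left _
  have hdiff : x - v = ∑ i ∈ Finset.range j, b i * 2 ^ i - b j * 2 ^ j := by
    rw [hx, hv, ← Finset.sum_range_add_sum_Ico _ hkm, Finset.sum_range_succ,
      Nat.add_sub_cancel]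
    ring
  obtain ⟨h₀, h₁⟩ := sum_bits_mem_Ico b j fun i hi => hb i (by omega)
  have hle : |x - v| ≤ 2 ^ j := by
    rw [hdiff, abs_le]
    rcases hb j (by omega) with h | h <;> rw [h] <;> constructor <;> linarith
  refine ⟨hdvd, fun n => ?_⟩
  obtain ⟨q, rfl⟩ := hdvd
  rw [mul_comm _ q] at hle ⊢
  exact abs_sub_mul_le_abs_sub_mul (by rw [pow_succ (2 : ℤ) j] at hle ⊢; linarith) n
end

section
/- Let m ≥ 1, b : ℕ → ℤ with b i ∈ {0,1} for all i ≤ m, and r ∈ {0,1}. Let X = −(b m) * 2^m + ∑_{i < m} b i * 2^i + r be the value of the canonical RN-encoding (b, r) with unit 1. Then the bitwise complemented encoding represents −X: that is, −X = −(1 − b m) * 2^m + ∑_{i < m} (1 − b i) * 2^i + (1 − r). -/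
/-- Bitwise complementation of a canonical RN-encoding
(2's complement bits together with the round bit) represents the negated
value. -/
theorem negation_by_complement (m : ℕ) (hm : 1 ≤ m) (b : ℕ → ℤ)
    (hb : ∀ i ≤ m, b i = 0 ∨ b i = 1) (r : ℤ) (hr : r = 0 ∨ r = 1) (X : ℤ)
    (hX : X = -(b m) * 2 ^ m + (∑ i ∈ Finset.range m, b i * 2 ^ i) + r) :
    -X = -(1 - b m) * 2 ^ m + (∑ i ∈ Finset.range m, (1 - b i) * 2 ^ i) +
        (1 - r) := by
  have geom : ∑ i ∈ Finset.range m, (2 : ℤ) ^ i = 2 ^ m - 1 := by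
    simpa using geom_sum_mul (2 : ℤ) m
  simp only [sub_mul, one_mul, Finset.sum_sub_distrib, geom]
  rw [hX]
  ring
end

section
/- Let m ≥ 1, b : ℕ → ℤ with b i ∈ {0,1} for all i ≤ m, and r ∈ {0,1}. Define the signed-digit interpretation δ : ℕ → ℤ of the canonical RN-encoding (b, r) by δ 0 = r − b 0 and δ i = b (i−1) − b i for 1 ≤ i ≤ m. If k ≤ m is the least index with δ k ≠ 0, then δ k = 2r − 1; that is, if r = 1 the least significant nonzero signed digit equals 1, and if r = 0 it equals −1. -/
/-- While all signed digits vanish, every bit equals the round bit. -/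
theorem bit_eq_round_bit_of_signed_digits_eq_zero {m : ℕ} {b : ℕ → ℤ} {r : ℤ} {δ : ℕ → ℤ}
    (hδ0 : δ 0 = r - b 0) (hδ : ∀ i, 1 ≤ i → i ≤ m → δ i = b (i - 1) - b i)
    {n : ℕ} (hn : n ≤ m) (hzero : ∀ j ≤ n, δ j = 0) : b n = r := by
  induction n with
  | zero =>
    have := hzero 0 le_rfl
    omega
  | succ n ih =>
    have hb := ih (by omega) fun j hj => hzero j (by omega)
    have hd := hδ (n + 1) (by omega) hn
    rw [hzero (n + 1) le_rfl, Nat.add_sub_cancel] at hd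
    omega

/-- **Lemma: tail sign.** In the signed-digit interpretation of a
canonical RN-encoding `(b, r)`, the least significant nonzero digit equals
`2r − 1`: it is `1` when the round bit is `1` and `−1` when the round bit is
`0`. -/
theorem least_nonzero_signed_digit (m : ℕ) (hm : 1 ≤ m) (b : ℕ → ℤ)
    (hb : ∀ i ≤ m, b i = 0 ∨ b i = 1) (r : ℤ) (hr : r = 0 ∨ r = 1)
    (δ : ℕ → ℤ) (hδ0 : δ 0 = r - b 0)
    (hδ : ∀ i, 1 ≤ i → i ≤ m → δ i = b (i - 1) - b i)
    (k : ℕ) (hk : k ≤ m) (hknz : δ k ≠ 0) (hleast : ∀ j < k, δ j = 0) :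
    δ k = 2 * r - 1 := by
  have hbk := hb k hk
  cases k with
  | zero => omega
  | succ n =>
    have hbn := bit_eq_round_bit_of_signed_digits_eq_zero hδ0 hδ (n := n) (by omega)
      fun j hj => hleast j (by omega)
    have hd := hδ (n + 1) (by omega) hk
    rw [Nat.add_sub_cancel] at hd
    omega
end

section
/- Let a, b : ℝ, let r_a, r_b ∈ {0,1} (viewed as reals), and let u > 0. Define the sum encoding s = a + b + min r_a r_b * u with round bit r_s = max r_a r_b. Then (i) the value is preserved exactly: s + r_s * u = (a + r_a * u) + (b + r_b * u); and (ii) the interval inclusion condition holds: inv(s, r_s) ⊆ inv(a, r_a) + inv(b, r_b), where the sum of sets is the Minkowski sum { x + y : x ∈ inv(a, r_a), y ∈ inv(b, r_b) }. -/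
open Pointwise

/-- Addition of RN-encoded numbers
`(a, r_a) ⊕ (b, r_b) = (a + b + (r_a ∧ r_b)·u, r_a ∨ r_b)` preserves the value
exactly, and its interval interpretation is included in the Minkowski sum of
the operands' interval interpretations. -/
theorem RN_addition_correct (a b u ra rb : ℝ) (hra : ra = 0 ∨ ra = 1)
    (hrb : rb = 0 ∨ rb = 1) (hu : 0 < u) :
    ((a + b + min ra rb * u) + max ra rb * u = (a + ra * u) + (b + rb * u)) ∧
      Set.Icc ((a + b + min ra rb * u) + max ra rb * u / 2)
          ((a + b + min ra rb * u) + (1 + max ra rb) * u / 2) ⊆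
        Set.Icc (a + ra * u / 2) (a + (1 + ra) * u / 2) +
          Set.Icc (b + rb * u / 2) (b + (1 + rb) * u / 2) := by
  refine ⟨by rw [add_assoc (a + b), ← add_mul, min_add_max]; ring, ?_⟩
  rw [Set.Icc_add_Icc (by linarith) (by linarith)]
  apply Set.Icc_subset_Icc <;>
    rcases hra with rfl | rfl <;> rcases hrb with rfl | rfl <;> norm_num <;> linarith
end

section
/- Let u : ℝ with 0 < u ≤ 1, let x, y : ℝ with 1 ≤ x ≤ 2 − u and 1 ≤ y ≤ 2 − u, let r_x, r_y ∈ {0,1} (viewed as reals), and let q = (x + r_x*u/2) / (y + r_y*u/2). Then for every real ε with |ε| < u/8, the approximate quotient q + ε lies strictly within the required interval: (x + r_x*u/2) / (y + (1+r_y)*u/2) < q + ε < (x + (1+r_x)*u/2) / (y + r_y*u/2). -/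
/-- Enlarging a denominator in `(0, 2 - h]` by `h` lowers a quotient with numerator at least `1`
by at least `h / 4`. -/
theorem div_add_le_div_sub_quarter {a b h : ℝ} (hh : 0 ≤ h) (ha : 1 ≤ a) (hb : 0 < b)
    (hbh : b + h ≤ 2) : a / (b + h) ≤ a / b - h / 4 := by
  have hbh0 : 0 < b + h := by linarith
  have hprod : b * (b + h) ≤ 4 * a := by nlinarith
  have hdiff : a / b - a / (b + h) = h * a / (b * (b + h)) := by
    field_simp
    ring
  have hquarter : h / 4 ≤ h * a / (b * (b + h)) := by
    rw [le_div_iff₀ (mul_pos hb hbh0)]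
    nlinarith [mul_le_mul_of_nonneg_left hprod hh]
  linarith

/-- For scaled operands `1 ≤ x, y ≤ 2 − u`, any approximation
`q + ε` of the exact quotient `q = (x + r_x·u/2)/(y + r_y·u/2)` with error
`|ε| < u/8` lies strictly within the interval required for correct rounding of
the division. -/
theorem approximate_quotient_accuracy (u x y rx ry : ℝ) (hu0 : 0 < u)
    (hu1 : u ≤ 1) (hx1 : 1 ≤ x) (hx2 : x ≤ 2 - u) (hy1 : 1 ≤ y)
    (hy2 : y ≤ 2 - u) (hrx : rx = 0 ∨ rx = 1) (hry : ry = 0 ∨ ry = 1)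
    (ε : ℝ) (hε : |ε| < u / 8) :
    (x + rx * u / 2) / (y + (1 + ry) * u / 2) <
        (x + rx * u / 2) / (y + ry * u / 2) + ε ∧
      (x + rx * u / 2) / (y + ry * u / 2) + ε <
        (x + (1 + rx) * u / 2) / (y + ry * u / 2) := by
  obtain ⟨hε₁, hε₂⟩ := abs_lt.mp hε
  have hrx0 : 0 ≤ rx * u := by rcases hrx with rfl | rfl <;> linarith
  have hry0 : 0 ≤ ry * u := by rcases hry with rfl | rfl <;> linarith
  have hry1 : ry * u ≤ u := by rcases hry with rfl | rfl <;> linarith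
  have hden : 0 < y + ry * u / 2 := by linarith
  constructor
  · have hle := div_add_le_div_sub_quarter (a := x + rx * u / 2) (b := y + ry * u / 2)
      (h := u / 2) (by linarith) (by linarith) hden (by linarith)
    rw [show y + (1 + ry) * u / 2 = y + ry * u / 2 + u / 2 by ring]
    linarith
  · have hle : u / 8 ≤ u / 2 / (y + ry * u / 2) := by
      rw [le_div_iff₀ hden]
      nlinarith
    rw [show x + (1 + rx) * u / 2 = x + rx * u / 2 + u / 2 by ring, add_div _ (u / 2)]
    linarith
end

section
/- Let p ≥ 1 be a natural number, u = 2^(1−p) : ℝ, and let e_a, e_b : ℤ with e_a > e_b + p. Let m_a, m_b : ℝ and r_a, r_b ∈ {0,1} (viewed as reals), and assume the smaller operand is nonnegative and bounded by the significand range: 0 ≤ m_b + r_b*u/2 and m_b + (1+r_b)*u/2 ≤ 2. Then (i) (2:ℝ)^e_b • inv(m_b, r_b) ⊆ Set.Icc 0 ((2:ℝ)^e_a * u/2), and (ii) Set.Icc ((2:ℝ)^e_a * (m_a + u/2)) ((2:ℝ)^e_a * (m_a + u)) ⊆ (2:ℝ)^e_a • inv(m_a, r_a) + Set.Icc 0 ((2:ℝ)^e_a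 * u/2), where • is pointwise scaling of a set and + is the Minkowski sum. Hence the result of the far-case addition may be represented with the significand of the larger operand and round bit 1. -/
open Pointwise

/-- **Lemma, far-case addition.** If the exponents satisfy
`e_a > e_b + p`, the smaller (nonnegative) operand's interval fits in
`[0, 2^e_a · u/2]`, and the sum may be represented with the significand of the
larger operand and round bit `1`. -/
theorem far_case_addition (p : ℕ) (hp : 1 ≤ p) (u : ℝ)
    (hu : u = 2 ^ (1 - (p : ℤ))) (ea eb : ℤ) (he : eb + (p : ℤ) < ea)
    (ma mb ra rb : ℝ) (hra : ra = 0 ∨ ra = 1) (hrb : rb = 0 ∨ rb = 1)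
    (hmb0 : 0 ≤ mb + rb * u / 2) (hmb2 : mb + (1 + rb) * u / 2 ≤ 2) :
    (2 : ℝ) ^ eb • Set.Icc (mb + rb * u / 2) (mb + (1 + rb) * u / 2) ⊆
        Set.Icc 0 ((2 : ℝ) ^ ea * u / 2) ∧
      Set.Icc ((2 : ℝ) ^ ea * (ma + u / 2)) ((2 : ℝ) ^ ea * (ma + u)) ⊆
        (2 : ℝ) ^ ea • Set.Icc (ma + ra * u / 2) (ma + (1 + ra) * u / 2) +
          Set.Icc 0 ((2 : ℝ) ^ ea * u / 2) := by
  have hE : (0 : ℝ) < 2 ^ ea := by positivity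
  have hB : (0 : ℝ) < 2 ^ eb := by positivity
  have hu0 : 0 < u := by rw [hu]; positivity
  constructor
  · have key : (2 : ℝ) ^ eb * 2 ≤ 2 ^ ea * u / 2 := by
      have h₁ : (2 : ℝ) ^ eb * 2 = 2 ^ (eb + 1) := by
        rw [zpow_add_one₀ two_ne_zero]
      have h₂ : (2 : ℝ) ^ ea * u / 2 = 2 ^ (ea + (1 - (p : ℤ)) - 1) := by
        rw [hu, zpow_sub_one₀ two_ne_zero, zpow_add₀ two_ne_zero, div_eq_mul_inv]
      rw [h₁, h₂]
      exact zpow_le_zpow_right₀ one_le_two (by omega)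
    rintro _ ⟨x, ⟨hx₁, hx₂⟩, rfl⟩
    exact ⟨mul_nonneg hB.le (hmb0.trans hx₁),
      (mul_le_mul_of_nonneg_left (hx₂.trans hmb2) hB.le).trans key⟩
  · rintro x ⟨hx₁, hx₂⟩
    have hEu : 0 < (2 : ℝ) ^ ea * u := mul_pos hE hu0
    rw [← Set.image_smul]
    simp only [smul_eq_mul]
    rw [Set.image_mul_left_Icc' hE]
    rcases hra with rfl | rfl
    · exact Set.mem_add.2 ⟨x - 2 ^ ea * u / 2, ⟨by linarith, by linarith⟩,
        2 ^ ea * u / 2, ⟨by linarith, le_rfl⟩, by ring⟩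
    · exact Set.mem_add.2 ⟨x, ⟨by linarith, by linarith⟩,
        0, ⟨le_rfl, by linarith⟩, by ring⟩
end

section
/- Let k ≥ 1 and let a, x, s : ℤ and r ∈ {0,1} with 2^k ∣ a, x = a + r * 2^k + s, and the tail-sign conditions: if r = 0 then 0 ≤ s < 2^(k−1), and if r = 1 then −2^(k−1) ≤ s ≤ 0. Then rounding is achieved by adjusting only the round bit: (i) round up: a + (if s ≠ 0 then 1 else r) * 2^k is the least multiple of 2^k that is ≥ x; (ii) round down: a + (if s ≠ 0 then 0 else r) * 2^k is the greatest multiple of 2^k that is ≤ x. -/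
theorem Int.isLeast_dvd_and_le {d c x : ℤ} (hc : d ∣ c) (hxc : x ≤ c) (hcx : c < x + d) :
    IsLeast {v : ℤ | d ∣ v ∧ x ≤ v} c := by
  refine ⟨⟨hc, hxc⟩, fun v ⟨hv, hxv⟩ => ?_⟩
  by_contra! hlt
  have := Int.le_of_dvd (by omega) (Int.dvd_sub hc hv)
  omega

theorem Int.isGreatest_dvd_and_le {d c x : ℤ} (hc : d ∣ c) (hcx : c ≤ x) (hxc : x < c + d) :
    IsGreatest {v : ℤ | d ∣ v ∧ v ≤ x} c := by
  refine ⟨⟨hc, hcx⟩, fun v ⟨hv, hvx⟩ => ?_⟩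
  by_contra! hlt
  have := Int.le_of_dvd (by omega) (Int.dvd_sub hv hc)
  omega

/-- Directed roundings up and down of a canonically
RN-encoded value `x = a + r·2^k + s` (with tail-sign conditions on the
discarded tail `s`) are realized by merely forcing the round bit when the
sticky tail `s` is nonzero: no incrementation is needed. -/
theorem directed_rounding_up_down (k : ℕ) (hk : 1 ≤ k) (a x s r : ℤ)
    (hr : r = 0 ∨ r = 1) (ha : (2 ^ k : ℤ) ∣ a)
    (hx : x = a + r * 2 ^ k + s)
    (h0 : r = 0 → 0 ≤ s ∧ s < 2 ^ (k - 1))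
    (h1 : r = 1 → -2 ^ (k - 1) ≤ s ∧ s ≤ 0) :
    IsLeast {v : ℤ | (2 ^ k : ℤ) ∣ v ∧ x ≤ v}
        (a + (if s ≠ 0 then 1 else r) * 2 ^ k) ∧
      IsGreatest {v : ℤ | (2 ^ k : ℤ) ∣ v ∧ v ≤ x}
        (a + (if s ≠ 0 then 0 else r) * 2 ^ k) := by
  have hpow : (2 : ℤ) ^ k = 2 * 2 ^ (k - 1) := by
    rw [← pow_succ', Nat.sub_add_cancel hk]
  have hpos : (0 : ℤ) < 2 ^ (k - 1) := by positivity
  constructor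
  · refine Int.isLeast_dvd_and_le (ha.add (Dvd.intro_left _ rfl)) ?_ ?_ <;>
      rcases hr with rfl | rfl <;> split_ifs <;> grind
  · refine Int.isGreatest_dvd_and_le (ha.add (Dvd.intro_left _ rfl)) ?_ ?_ <;>
      rcases hr with rfl | rfl <;> split_ifs <;> grind
end

section
/- Let k ≥ 1 and let a, x, s : ℤ and r ∈ {0,1} with 2^k ∣ a, x = a + r * 2^k + s, and the tail-sign conditions: if r = 0 then 0 ≤ s < 2^(k−1), and if r = 1 then −2^(k−1) ≤ s ≤ 0. Let s_a = (if a < 0 then 1 else 0) be the sign bit. Then (i) round toward zero: with r' = (if s ≠ 0 then s_a else r), the value a + r' * 2^k is the greatest multiple of 2^k that is ≤ x when x ≥ 0, and the least multiple of 2^k that is ≥ x when x < 0; (ii) round away from zero: with r'' = (if s ≠ 0 then 1 − s_a else r), the value a + r'' * 2^k is the least multiple of 2^k that is ≥ x when x ≥ 0, and the greatest multiple of 2^k that is ≤ x when x < 0. -/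
theorem Int.isGreatest_dvd_le {p b x : ℤ} (hb : p ∣ b) (hle : b ≤ x) (hlt : x < b + p) :
    IsGreatest {v : ℤ | p ∣ v ∧ v ≤ x} b := by
  refine ⟨⟨hb, hle⟩, fun v ⟨hv, hvx⟩ => ?_⟩
  by_contra! h
  have := Int.le_of_dvd (sub_pos.2 h) (dvd_sub hv hb)
  omega

theorem Int.isLeast_dvd_ge {p b x : ℤ} (hb : p ∣ b) (hle : x ≤ b) (hlt : b - p < x) :
    IsLeast {v : ℤ | p ∣ v ∧ x ≤ v} b := by
  refine ⟨⟨hb, hle⟩, fun v ⟨hv, hvx⟩ => ?_⟩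
  by_contra! h
  have := Int.le_of_dvd (sub_pos.2 h) (dvd_sub hb hv)
  omega


/-- Directed roundings toward zero and away from zero of a
canonically RN-encoded value `x = a + r·2^k + s` (with tail-sign conditions on
the discarded tail `s`) are realized by forcing the round bit to the sign bit,
respectively its complement, when the sticky tail `s` is nonzero. -/
theorem directed_rounding_to_from_zero (k : ℕ) (hk : 1 ≤ k) (a x s r : ℤ)
    (hr : r = 0 ∨ r = 1) (ha : (2 ^ k : ℤ) ∣ a)
    (hx : x = a + r * 2 ^ k + s)
    (h0 : r = 0 → 0 ≤ s ∧ s < 2 ^ (k - 1))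
    (h1 : r = 1 → -2 ^ (k - 1) ≤ s ∧ s ≤ 0) :
    ((0 ≤ x → IsGreatest {v : ℤ | (2 ^ k : ℤ) ∣ v ∧ v ≤ x}
        (a + (if s ≠ 0 then (if a < 0 then 1 else 0) else r) * 2 ^ k)) ∧
      (x < 0 → IsLeast {v : ℤ | (2 ^ k : ℤ) ∣ v ∧ x ≤ v}
        (a + (if s ≠ 0 then (if a < 0 then 1 else 0) else r) * 2 ^ k))) ∧
    ((0 ≤ x → IsLeast {v : ℤ | (2 ^ k : ℤ) ∣ v ∧ x ≤ v}
        (a + (if s ≠ 0 then 1 - (if a < 0 then 1 else 0) else r) * 2 ^ k)) ∧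
      (x < 0 → IsGreatest {v : ℤ | (2 ^ k : ℤ) ∣ v ∧ v ≤ x}
        (a + (if s ≠ 0 then 1 - (if a < 0 then 1 else 0) else r) * 2 ^ k))) := by
  have hpow : (2 ^ k : ℤ) = 2 * 2 ^ (k - 1) := by
    rw [← pow_succ', Nat.sub_add_cancel hk]
  have hpos : (0 : ℤ) < 2 ^ (k - 1) := by positivity
  have hdvd (c : ℤ) : (2 ^ k : ℤ) ∣ a + c * 2 ^ k := dvd_add ha (dvd_mul_left _ _)
  have hneg : a < 0 → a + 2 ^ k ≤ 0 := fun h => by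
    have := Int.le_of_dvd (neg_pos.2 h) (dvd_neg.2 ha)
    omega
  generalize (2 ^ k : ℤ) = p at *
  generalize (2 ^ (k - 1) : ℤ) = q at *
  refine ⟨⟨fun h => Int.isGreatest_dvd_le (hdvd _) ?_ ?_,
      fun h => Int.isLeast_dvd_ge (hdvd _) ?_ ?_⟩,
    ⟨fun h => Int.isLeast_dvd_ge (hdvd _) ?_ ?_,
      fun h => Int.isGreatest_dvd_le (hdvd _) ?_ ?_⟩⟩ <;>
  rcases hr with rfl | rfl <;> split_ifs <;> simp at * <;> omega
end
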